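/- arXiv:1312.4527 — 2 statements merged into one kernel-verified Lean document; each statement's English description precedes it below -/
import Mathlib

section
/- Let K ≥ 2 and let z be a Gaussian random vector in ℝ^{K-1} with mean 0 and symmetric positive definite covariance matrix A, and set σ = max_i A_{ii}. Fix a symmetric positive definite (K-1)×(K-1) matrix S with λ_min(S) ≥ 1, and let B = I_{K-1} − S + diag(z). Then Pr(λ_max(B) ≥ 0) ≤ (K−1)²·exp(−(1 − λ_min(S))²/(2σ)). -/
open MeasureTheory Matrix

/-- The largest eigenvalue of a real symmetric (Hermitian) matrix. -/
noncomputable def eigMax {m : Type*} [Fintype m] [DecidableEq m] {A : Matrix m m ℝ}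
    (hA : A.IsHermitian) : ℝ := ⨆ i, hA.eigenvalues i

/-- The smallest eigenvalue of a real symmetric (Hermitian) matrix. -/
noncomputable def eigMin {m : Type*} [Fintype m] [DecidableEq m] {A : Matrix m m ℝ}
    (hA : A.IsHermitian) : ℝ := ⨅ i, hA.eigenvalues i

/-- A real matrix is negative semidefinite iff its negation is positive semidefinite. -/
def NegSemidefR {m : Type*} [Fintype m] (A : Matrix m m ℝ) : Prop := (-A).PosSemidef

/-- The multivariate Gaussian measure `N(μ, S)` on `ℝⁿ`, given by its density with
respect to Lebesgue measure. -/
noncomputable def gaussianPi (n : ℕ) (μ : Fin n → ℝ) (S : Matrix (Fin n) (Fin n) ℝ) :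
    Measure (Fin n → ℝ) :=
  volume.withDensity fun x =>
    ENNReal.ofReal (Real.sqrt (((2 * Real.pi) ^ n * S.det)⁻¹) *
      Real.exp (-(1/2) * ((x - μ) ⬝ᵥ (S⁻¹ *ᵥ (x - μ)))))

/-- `log x̃ = (log (x₁/x_K), …, log (x_{K-1}/x_K))` for `x ∈ ℝ^{n+1}` (here `K = n+1`). -/
noncomputable def logTilde (n : ℕ) (x : Fin (n+1) → ℝ) : Fin n → ℝ :=
  fun i => Real.log (x i.castSucc / x (Fin.last n))

/-- The logistic-normal function
`LN(x; μ, Σ) = -(1/2)(log x̃ - μ)ᵀ Σ⁻¹ (log x̃ - μ) - ∑ₖ log xₖ` on `ℝ^{n+1}`. -/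
noncomputable def LN (n : ℕ) (μ : Fin n → ℝ) (S : Matrix (Fin n) (Fin n) ℝ)
    (x : Fin (n+1) → ℝ) : ℝ :=
  -(1/2) * ((logTilde n x - μ) ⬝ᵥ (S⁻¹ *ᵥ (logTilde n x - μ))) - ∑ k, Real.log (x k)

/-- The logistic transformation `y ↦ (e^{y₁}, …, e^{y_n}, 1) / (1 + ∑ₕ e^{y_h})`,
mapping `ℝⁿ` onto the open simplex in `ℝ^{n+1}`. -/
noncomputable def logisticMap (n : ℕ) (y : Fin n → ℝ) : Fin (n+1) → ℝ :=
  fun k => (Fin.snoc (fun i => Real.exp (y i)) 1 : Fin (n+1) → ℝ) k /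
    ∑ j, (Fin.snoc (fun i => Real.exp (y i)) 1 : Fin (n+1) → ℝ) j

/-- The Hessian matrix of second partial derivatives of `f` at `x`. -/
noncomputable def hessian {m : ℕ} (f : (Fin m → ℝ) → ℝ) (x : Fin m → ℝ) :
    Matrix (Fin m) (Fin m) ℝ :=
  Matrix.of fun i j =>
    fderiv ℝ (fun y => fderiv ℝ f y (Pi.single j (1:ℝ))) x (Pi.single i (1:ℝ))

/-- `I - S + diag z` is symmetric whenever `S` is. -/
theorem isHermitian_B {n : ℕ} {S : Matrix (Fin n) (Fin n) ℝ} (hS : S.IsHermitian)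
    (z : Fin n → ℝ) : (1 - S + Matrix.diagonal z).IsHermitian :=
  (Matrix.isHermitian_one.sub hS).add (Matrix.isHermitian_diagonal z)

/-- The unnormalized standard Gaussian density on `ℝⁿ` has total mass `√(2π) ^ n`. -/
lemma lintegral_exp_neg_half_dotProduct_self (n : ℕ) :
    ∫⁻ y : Fin n → ℝ, ENNReal.ofReal (Real.exp (-(1/2) * (y ⬝ᵥ y)))
      = ENNReal.ofReal (Real.sqrt (2 * Real.pi) ^ n) := by
  have hprod : ∀ y : Fin n → ℝ, Real.exp (-(1/2) * (y ⬝ᵥ y))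
      = ∏ i, Real.exp (-(1/2) * (y i) ^ 2) := by
    intro y
    rw [← Real.exp_sum, dotProduct, Finset.mul_sum]
    simp only [pow_two]
  have hint : Integrable (fun y : Fin n → ℝ => ∏ i, Real.exp (-(1/2) * (y i) ^ 2)) :=
    Integrable.fintype_prod (f := fun _ (x : ℝ) => Real.exp (-(1/2) * x ^ 2))
      fun _ => integrable_exp_neg_mul_sq (by norm_num)
  simp_rw [hprod]
  rw [← ofReal_integral_eq_lintegral_ofReal hint
    (Filter.Eventually.of_forall fun y => Finset.prod_nonneg fun i _ => (Real.exp_pos _).le),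
    integral_fintype_prod_volume_eq_pow (fun x : ℝ => Real.exp (-(1/2) * x ^ 2)),
    integral_gaussian, Fintype.card_fin]
  congr 3
  ring

/-- Gaussian integral of the quadratic form `x ↦ |N x|²`, for an invertible matrix `N`. -/
lemma lintegral_exp_neg_half_mulVec {n : ℕ} {N : Matrix (Fin n) (Fin n) ℝ} (hN : N.det ≠ 0) :
    ∫⁻ x : Fin n → ℝ, ENNReal.ofReal (Real.exp (-(1/2) * ((N *ᵥ x) ⬝ᵥ (N *ᵥ x))))
      = ENNReal.ofReal (|N.det⁻¹| * Real.sqrt (2 * Real.pi) ^ n) := by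
  have hmeas : Measurable fun y : Fin n → ℝ =>
      ENNReal.ofReal (Real.exp (-(1/2) * (y ⬝ᵥ y))) := by
    unfold dotProduct
    fun_prop
  have hlin : Measurable (toLin' N) :=
    (LinearMap.continuous_of_finiteDimensional (toLin' N)).measurable
  have h := lintegral_map (μ := volume) hmeas hlin
  rw [Real.map_matrix_volume_pi_eq_smul_volume_pi hN, lintegral_smul_measure,
    lintegral_exp_neg_half_dotProduct_self, smul_eq_mul,
    ← ENNReal.ofReal_mul (abs_nonneg _)] at h
  simpa only [toLin'_apply] using h.symm

open scoped MatrixOrder in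
/-- A real positive definite matrix is `Nᵀ * N` for an invertible `N`. -/
lemma Matrix.PosDef.exists_eq_transpose_mul_self {n : ℕ} {M : Matrix (Fin n) (Fin n) ℝ}
    (hM : M.PosDef) : ∃ N : Matrix (Fin n) (Fin n) ℝ, N.det ≠ 0 ∧ M = Nᵀ * N := by
  obtain ⟨N, hN⟩ := CStarAlgebra.nonneg_iff_eq_star_mul_self.mp hM.posSemidef.nonneg
  rw [star_eq_conjTranspose, conjTranspose_eq_transpose_of_trivial] at hN
  refine ⟨N, fun h => hM.det_pos.ne' ?_, hN⟩
  rw [hN, det_mul, h, mul_zero]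

/-- The Gaussian density of a positive definite covariance has total mass one. -/
lemma lintegral_gaussian_density_eq_one {n : ℕ} {A : Matrix (Fin n) (Fin n) ℝ} (hA : A.PosDef) :
    ∫⁻ x : Fin n → ℝ, ENNReal.ofReal (Real.sqrt (((2 * Real.pi) ^ n * A.det)⁻¹) *
      Real.exp (-(1/2) * (x ⬝ᵥ (A⁻¹ *ᵥ x)))) = 1 := by
  obtain ⟨N, hN, hNA⟩ := hA.inv.exists_eq_transpose_mul_self
  have hquad : ∀ x, x ⬝ᵥ (A⁻¹ *ᵥ x) = (N *ᵥ x) ⬝ᵥ (N *ᵥ x) := by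
    intro x
    rw [hNA, ← mulVec_mulVec, dotProduct_mulVec, vecMul_transpose]
  have hdet : A.det⁻¹ = N.det ^ 2 := by
    have h := congrArg det hNA
    rw [det_nonsing_inv, Ring.inverse_eq_inv', det_mul, det_transpose] at h
    rw [h, sq]
  simp_rw [hquad, ENNReal.ofReal_mul (Real.sqrt_nonneg _)]
  rw [lintegral_const_mul' _ _ ENNReal.ofReal_ne_top, lintegral_exp_neg_half_mulVec hN,
    ← ENNReal.ofReal_mul (Real.sqrt_nonneg _), mul_inv, hdet,
    Real.sqrt_mul (by positivity), Real.sqrt_sq_eq_abs, abs_inv, Real.sqrt_inv]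
  have hpow : Real.sqrt ((2 * Real.pi) ^ n) = Real.sqrt (2 * Real.pi) ^ n := by
    rw [Real.sqrt_eq_iff_mul_self_eq (by positivity) (by positivity), ← mul_pow,
      Real.mul_self_sqrt (by positivity)]
  have h1 : Real.sqrt (2 * Real.pi) ^ n ≠ 0 := by positivity
  have h2 : |N.det| ≠ 0 := abs_ne_zero.mpr hN
  rw [hpow, ← ENNReal.ofReal_one]
  congr 1
  field_simp

/-- Completing the square in a Gaussian density tilted in a coordinate direction. -/
lemma dotProduct_inv_mulVec_sub_smul_col {n : ℕ} {A : Matrix (Fin n) (Fin n) ℝ} (hA : A.PosDef)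
    (i : Fin n) (s : ℝ) (z : Fin n → ℝ) :
    (z - s • A.col i) ⬝ᵥ (A⁻¹ *ᵥ (z - s • A.col i))
      = z ⬝ᵥ (A⁻¹ *ᵥ z) - 2 * s * z i + s ^ 2 * A i i := by
  have hdet : IsUnit A.det := hA.det_pos.ne'.isUnit
  have hcol : A⁻¹ *ᵥ A.col i = Pi.single i 1 := by
    rw [← mulVec_single_one, mulVec_mulVec, nonsing_inv_mul _ hdet, one_mulVec]
  have hsymm : A.col i ⬝ᵥ (A⁻¹ *ᵥ z) = z i := by
    have hT : (A⁻¹)ᵀ = A⁻¹ := by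
      rw [← conjTranspose_eq_transpose_of_trivial]
      exact hA.inv.isHermitian
    rw [dotProduct_mulVec, ← mulVec_transpose, hT, hcol, single_one_dotProduct]
  simp only [mulVec_sub, mulVec_smul, sub_dotProduct, dotProduct_sub, smul_dotProduct,
    dotProduct_smul, hcol, hsymm, dotProduct_single_one, smul_eq_mul, col_apply,
    Pi.sub_apply, Pi.smul_apply]
  ring

/-- Chernoff bound for a coordinate of a centered Gaussian vector. -/
lemma gaussianPi_coord_ge_le {n : ℕ} {A : Matrix (Fin n) (Fin n) ℝ} (hA : A.PosDef)
    (i : Fin n) {t : ℝ} (ht : 0 ≤ t) :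
    gaussianPi n 0 A {z | t ≤ z i} ≤ ENNReal.ofReal (Real.exp (-(t ^ 2 / (2 * A i i)))) := by
  have hAi : 0 < A i i := hA.diag_pos
  set c := Real.sqrt (((2 * Real.pi) ^ n * A.det)⁻¹)
  set s := t / A i i with hs
  have hs0 : 0 ≤ s := by positivity
  have hms : MeasurableSet {z : Fin n → ℝ | t ≤ z i} :=
    measurableSet_le measurable_const (measurable_pi_apply i)
  have hbound : ∀ z ∈ {z : Fin n → ℝ | t ≤ z i},
      ENNReal.ofReal (c * Real.exp (-(1/2) * ((z - 0) ⬝ᵥ (A⁻¹ *ᵥ (z - 0)))))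
        ≤ ENNReal.ofReal (Real.exp (-(t ^ 2 / (2 * A i i)))) *
          ENNReal.ofReal (c * Real.exp
            (-(1/2) * ((z - s • A.col i) ⬝ᵥ (A⁻¹ *ᵥ (z - s • A.col i))))) := by
    intro z hz
    rw [← ENNReal.ofReal_mul (Real.exp_pos _).le, mul_left_comm, ← Real.exp_add]
    refine ENNReal.ofReal_le_ofReal (mul_le_mul_of_nonneg_left (Real.exp_le_exp.mpr ?_)
      (Real.sqrt_nonneg _))
    rw [sub_zero, dotProduct_inv_mulVec_sub_smul_col hA]
    have h1 : s * t ≤ s * z i := mul_le_mul_of_nonneg_left hz hs0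
    have h2 : t ^ 2 / (2 * A i i) = s * t / 2 := by rw [hs]; field_simp
    have h3 : s ^ 2 * A i i = s * t := by rw [hs]; field_simp
    rw [h2, h3]
    linarith
  rw [gaussianPi, withDensity_apply _ hms]
  calc _ ≤ ∫⁻ z in {z : Fin n → ℝ | t ≤ z i}, _ := setLIntegral_mono' hms hbound
    _ ≤ ∫⁻ z : Fin n → ℝ, _ := setLIntegral_le_lintegral _ _
    _ = ENNReal.ofReal (Real.exp (-(t ^ 2 / (2 * A i i)))) := by
      rw [lintegral_const_mul' _ _ ENNReal.ofReal_ne_top,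
        lintegral_sub_right_eq_self (fun z : Fin n → ℝ => ENNReal.ofReal
          (c * Real.exp (-(1/2) * (z ⬝ᵥ (A⁻¹ *ᵥ z))))) (s • A.col i),
        lintegral_gaussian_density_eq_one hA, mul_one]

open scoped MatrixOrder in
/-- Subtracting the smallest eigenvalue leaves a positive semidefinite matrix. -/
lemma posSemidef_sub_eigMin_smul_one {n : ℕ} {S : Matrix (Fin n) (Fin n) ℝ}
    (hS : S.IsHermitian) : (S - eigMin hS • (1 : Matrix (Fin n) (Fin n) ℝ)).PosSemidef := by
  rw [← Matrix.le_iff, ← Algebra.algebraMap_eq_smul_one]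
  refine algebraMap_le_of_le_spectrum (fun x hx => ?_) hS
  rw [hS.spectrum_real_eq_range_eigenvalues] at hx
  obtain ⟨i, rfl⟩ := hx
  exact ciInf_le (Set.finite_range _).bddBelow i

/-- If `I - S + diag z` has a nonnegative eigenvalue then some `z i` is at least
`λ_min(S) - 1`. -/
lemma exists_le_of_eigMax_nonneg {n : ℕ} (hn : 1 ≤ n) {S : Matrix (Fin n) (Fin n) ℝ}
    (hS : S.IsHermitian) {z : Fin n → ℝ} (hz : 0 ≤ eigMax (isHermitian_B hS z)) :
    ∃ i, eigMin hS - 1 ≤ z i := by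
  by_contra! hlt
  have : Nonempty (Fin n) := ⟨⟨0, hn⟩⟩
  have hpos : (-(1 - S + diagonal z)).PosDef := by
    have hd : (diagonal fun i => eigMin hS - 1 - z i).PosDef :=
      PosDef.diagonal fun i => sub_pos.mpr (hlt i)
    convert hd.posSemidef_add (posSemidef_sub_eigMin_smul_one hS) using 1
    ext i j
    by_cases hij : i = j
    · subst hij
      simp
      ring
    · simp [hij]
  obtain ⟨i, hi⟩ := exists_eq_ciSup_of_finite (f := (isHermitian_B hS z).eigenvalues)
  have hv : (⇑((isHermitian_B hS z).eigenvectorBasis i) : Fin n → ℝ) ≠ 0 := by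
    intro h
    exact (isHermitian_B hS z).eigenvectorBasis.toBasis.ne_zero i
      (by ext j; simpa using congrFun h j)
  have h1 := hpos.dotProduct_mulVec_pos hv
  have h2 := (isHermitian_B hS z).eigenvalues_eq i
  rw [neg_mulVec, dotProduct_neg] at h1
  rw [eigMax, ← hi, h2] at hz
  simp only [RCLike.re_to_real] at hz
  linarith

/-- For `z ~ N(0, A)` on `ℝ^{K-1}` (`K-1 = n ≥ 1`), `σ = max_i A_{ii}`,
`S` symmetric positive definite with `λ_min(S) ≥ 1`, and `B = I - S + diag z`,
`Pr(λ_max(B) ≥ 0) ≤ (K-1)² exp(-(1 - λ_min(S))²/(2σ))`. -/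
theorem stmt2 (n : ℕ) (hn : 1 ≤ n) (A : Matrix (Fin n) (Fin n) ℝ) (hA : A.PosDef)
    (sigma : ℝ) (hsigma : sigma = ⨆ i, A i i)
    (S : Matrix (Fin n) (Fin n) ℝ) (hS : S.PosDef)
    (hSmin : 1 ≤ eigMin hS.isHermitian) :
    gaussianPi n 0 A {z | 0 ≤ eigMax (isHermitian_B hS.isHermitian z)}
      ≤ ENNReal.ofReal
          ((n : ℝ) ^ 2 * Real.exp (-((1 - eigMin hS.isHermitian) ^ 2 / (2 * sigma)))) := by
  have hbdd : BddAbove (Set.range fun i => A i i) := (Set.finite_range _).bddAbove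
  have ht : 0 ≤ eigMin hS.isHermitian - 1 := sub_nonneg.mpr hSmin
  set t := eigMin hS.isHermitian - 1 with htdef
  have hterm : ∀ i, gaussianPi n 0 A {z | t ≤ z i}
      ≤ ENNReal.ofReal (Real.exp (-(t ^ 2 / (2 * sigma)))) := by
    intro i
    refine (gaussianPi_coord_ge_le hA i ht).trans
      (ENNReal.ofReal_le_ofReal (Real.exp_le_exp.mpr (neg_le_neg ?_)))
    have hAi : 0 < A i i := hA.diag_pos
    have hle : A i i ≤ sigma := hsigma ▸ le_ciSup hbdd i
    gcongr
  have hn1 : (1 : ℝ) ≤ n := by exact_mod_cast hn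
  calc gaussianPi n 0 A {z | 0 ≤ eigMax (isHermitian_B hS.isHermitian z)}
      ≤ gaussianPi n 0 A (⋃ i, {z | t ≤ z i}) :=
        measure_mono fun z hz =>
          Set.mem_iUnion.mpr (exists_le_of_eigMax_nonneg hn hS.isHermitian hz)
    _ ≤ ∑ i, gaussianPi n 0 A {z | t ≤ z i} := measure_iUnion_fintype_le _ _
    _ ≤ ∑ _i : Fin n, ENNReal.ofReal (Real.exp (-(t ^ 2 / (2 * sigma)))) :=
        Finset.sum_le_sum fun i _ => hterm i
    _ = ENNReal.ofReal (n * Real.exp (-(t ^ 2 / (2 * sigma)))) := by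
        rw [ENNReal.ofReal_mul (Nat.cast_nonneg n), ENNReal.ofReal_natCast]
        simp
    _ ≤ _ := by
        rw [← neg_sub, ← htdef, neg_sq]
        gcongr
        nlinarith
end

section
/- Let K ≥ 2, μ ∈ ℝ^{K-1}, and Σ a symmetric positive definite (K-1)×(K-1) real matrix. Define the K×K symmetric matrix S by: its top-left (K-1)×(K-1) block is Σ⁻¹, its entries S_{iK} = S_{Ki} = −∑_{t=1}^{K-1} (Σ⁻¹)_{it} for i < K, and S_{KK} = ∑_{i=1}^{K-1} ∑_{t=1}^{K-1} (Σ⁻¹)_{it}; define the K×(K-1) matrix U whose first K−1 rows are the rows of Σ⁻¹ and whose K-th row is (−∑_{t=1}^{K-1}(Σ⁻¹)_{t1}, …, −∑_{t=1}^{K-1}(Σ⁻¹)_{t,K-1}). Then for every x ∈ ℝ^K with all coordinates positive, the logistic-normal function LN(·; μ, Σ) is twice continuously differentiable at x and its Hessian matrix there equals diag(1/x) · ( I_K − S + diag(U·(log x̃ − μ)) ) · diag(1/x). -/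
open MeasureTheory Matrix

/-- The `K×K` matrix `S` built from `Σ⁻¹`: top-left block `Σ⁻¹`, last column/row the negated
row sums of `Σ⁻¹`, and bottom-right entry the sum of all entries of `Σ⁻¹` (here `K = n+1`). -/
noncomputable def Smat (n : ℕ) (T : Matrix (Fin n) (Fin n) ℝ) :
    Matrix (Fin (n+1)) (Fin (n+1)) ℝ :=
  Matrix.of fun i j =>
    Fin.lastCases
      (Fin.lastCases (∑ a, ∑ b, T a b) (fun j' => -∑ t, T j' t) j)
      (fun i' => Fin.lastCases (-∑ t, T i' t) (fun j' => T i' j') j)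
      i

/-- The `K×(K-1)` matrix `U` whose first `K-1` rows are those of `Σ⁻¹` and whose last row
is the vector of negated column sums of `Σ⁻¹` (here `K = n+1`). -/
noncomputable def Umat (n : ℕ) (T : Matrix (Fin n) (Fin n) ℝ) :
    Matrix (Fin (n+1)) (Fin n) ℝ :=
  Matrix.of fun i j => Fin.lastCases (-∑ t, T t j) (fun i' => T i' j) i

theorem Umat_eq_mul (n : ℕ) (T : Matrix (Fin n) (Fin n) ℝ) :
    Umat n T = Umat n 1 * T := by
  ext i j
  refine Fin.lastCases ?_ (fun i => ?_) i <;>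
    simp [Umat, Matrix.mul_apply, Matrix.one_apply]

theorem Smat_eq_mul (n : ℕ) {T : Matrix (Fin n) (Fin n) ℝ} (hT : T.IsSymm) :
    Smat n T = Umat n T * (Umat n 1)ᵀ := by
  ext i j
  refine Fin.lastCases ?_ (fun i => ?_) i <;> refine Fin.lastCases ?_ (fun j => ?_) j
  · simp [Smat, Umat, Matrix.mul_apply, Matrix.one_apply]
    exact Finset.sum_comm
  · simp [Smat, Umat, Matrix.mul_apply, Matrix.one_apply, hT.apply]
  · simp [Smat, Umat, Matrix.mul_apply, Matrix.one_apply]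
  · simp [Smat, Umat, Matrix.mul_apply, Matrix.one_apply]

theorem contDiffAt_logTilde {n : ℕ} {x : Fin (n+1) → ℝ} (hx : ∀ k, 0 < x k)
    {r : WithTop ℕ∞} (i : Fin n) : ContDiffAt ℝ r (fun y => logTilde n y i) x := by
  unfold logTilde
  refine ContDiffAt.log (ContDiffAt.div ?_ ?_ (hx _).ne') (div_pos (hx _) (hx _)).ne' <;>
    fun_prop

theorem contDiffAt_LN {n : ℕ} (μ : Fin n → ℝ) (S : Matrix (Fin n) (Fin n) ℝ)
    {x : Fin (n+1) → ℝ} (hx : ∀ k, 0 < x k) {r : WithTop ℕ∞} :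
    ContDiffAt ℝ r (LN n μ S) x := by
  have h := fun i => contDiffAt_logTilde hx (r := r) i
  have hl : ∀ k, ContDiffAt ℝ r (fun y : Fin (n+1) → ℝ => Real.log (y k)) x := fun k =>
    ContDiffAt.log (by fun_prop) (hx k).ne'
  unfold LN
  simp only [dotProduct, mulVec, Pi.sub_apply]
  fun_prop

theorem hasFDerivAt_logTilde {n : ℕ} {x : Fin (n+1) → ℝ} (hx : ∀ k, 0 < x k) (i : Fin n) :
    HasFDerivAt (fun y => logTilde n y i)
      ((x i.castSucc)⁻¹ • ContinuousLinearMap.proj (R := ℝ) (φ := fun _ => ℝ) i.castSucc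
        - (x (Fin.last n))⁻¹ • ContinuousLinearMap.proj (Fin.last n)) x := by
  have h : ∀ k, HasFDerivAt (fun y : Fin (n+1) → ℝ => Real.log (y k))
      ((x k)⁻¹ • ContinuousLinearMap.proj (R := ℝ) (φ := fun _ => ℝ) k) x := fun k =>
    (hasFDerivAt_apply k x).log (hx k).ne'
  refine ((h i.castSucc).sub (h (Fin.last n))).congr_of_eventuallyEq ?_
  have hpos : ∀ᶠ y in nhds x, ∀ k, 0 < y k := Filter.eventually_all.2 fun k =>
    (continuous_apply k).continuousAt.eventually_const_lt (hx k)
  filter_upwards [hpos] with y hy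
  exact Real.log_div (hy _).ne' (hy _).ne'

theorem fderiv_logTilde_single {n : ℕ} {x : Fin (n+1) → ℝ} (hx : ∀ k, 0 < x k)
    (i : Fin n) (j : Fin (n+1)) :
    fderiv ℝ (fun y => logTilde n y i) x (Pi.single j 1) = (x j)⁻¹ * Umat n 1 j i := by
  rw [(hasFDerivAt_logTilde hx i).fderiv]
  refine Fin.lastCases ?_ (fun j => ?_) j
  · simp [Umat, Matrix.one_apply, (Fin.castSucc_lt_last i).ne]
  · by_cases hij : i = j
    · subst hij
      simp [Umat, (Fin.castSucc_lt_last i).ne']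
    · simp [Umat, Matrix.one_apply, (Fin.castSucc_lt_last j).ne', hij,
        Ne.symm hij]

/-- The partial derivatives of the logistic-normal function. -/
theorem fderiv_LN_single {n : ℕ} (μ : Fin n → ℝ) {S : Matrix (Fin n) (Fin n) ℝ}
    (hS : S⁻¹.IsSymm) {x : Fin (n+1) → ℝ} (hx : ∀ k, 0 < x k) (j : Fin (n+1)) :
    fderiv ℝ (LN n μ S) x (Pi.single j 1) =
      -((x j)⁻¹ * ((Umat n S⁻¹ *ᵥ (logTilde n x - μ)) j + 1)) := by
  have hz : ∀ i, HasFDerivAt (fun y => logTilde n y i - μ i)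
      (fderiv ℝ (fun y => logTilde n y i) x) x := fun i =>
    ((contDiffAt_logTilde hx (r := 1) i).differentiableAt one_ne_zero).hasFDerivAt.sub_const _
  have hl : ∀ k, HasFDerivAt (fun y : Fin (n+1) → ℝ => Real.log (y k))
      ((x k)⁻¹ • ContinuousLinearMap.proj (R := ℝ) (φ := fun _ => ℝ) k) x := fun k =>
    (hasFDerivAt_apply k x).log (hx k).ne'
  have hq := ((HasFDerivAt.fun_sum fun i (_ : i ∈ Finset.univ) => (hz i).fun_mul
    (HasFDerivAt.fun_sum fun k (_ : k ∈ Finset.univ) => (hz k).const_mul (S⁻¹ i k))).const_mul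
    (-(1/2) : ℝ)).sub (HasFDerivAt.fun_sum fun k (_ : k ∈ Finset.univ) => hl k)
  have hLN : HasFDerivAt (LN n μ S) _ x := hq
  rw [hLN.fderiv]
  have hsum : ∑ k, (x k)⁻¹ * (Pi.single j 1 : Fin (n+1) → ℝ) k = (x j)⁻¹ := by
    simp [Pi.single_apply]
  simp only [_root_.sub_apply, _root_.smul_apply,
    _root_.sum_apply, _root_.add_apply, smul_eq_mul,
    ContinuousLinearMap.proj_apply, fderiv_logTilde_single hx, hsum]
  rw [Umat_eq_mul n S⁻¹, ← Matrix.mulVec_mulVec]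
  set z := logTilde n x - μ with hzdef
  have hzi : ∀ i, logTilde n x i - μ i = z i := fun i => rfl
  simp only [hzi, mulVec, dotProduct, Finset.sum_add_distrib, Finset.mul_sum, mul_add]
  have hswap : ∑ i, ∑ k, z i * (S⁻¹ i k * ((x j)⁻¹ * Umat n 1 j k)) =
      ∑ i, ∑ k, (x j)⁻¹ * (Umat n 1 j i * (S⁻¹ i k * z k)) := by
    rw [Finset.sum_comm]
    refine Finset.sum_congr rfl fun i _ => Finset.sum_congr rfl fun k _ => ?_
    rw [hS.apply]
    ring
  have hdiag : ∑ i, (∑ k, S⁻¹ i k * z k) * ((x j)⁻¹ * Umat n 1 j i) =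
      ∑ i, ∑ k, (x j)⁻¹ * (Umat n 1 j i * (S⁻¹ i k * z k)) := by
    refine Finset.sum_congr rfl fun i _ => ?_
    rw [Finset.sum_mul]
    exact Finset.sum_congr rfl fun k _ => by ring
  simp only [← Finset.mul_sum] at hswap hdiag ⊢
  rw [hswap, hdiag]
  ring

/-- For `K = n+1 ≥ 2`, `μ ∈ ℝ^{K-1}`, `Σ` symmetric positive definite,
and `x` in the positive orthant of `ℝ^K`, the logistic-normal function `LN(·; μ, Σ)` is twice
continuously differentiable at `x` and its Hessian there equals
`diag(1/x) · (I_K - S + diag(U·(log x̃ - μ))) · diag(1/x)`. -/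
theorem stmt13 (n : ℕ) (hn : 1 ≤ n) (μ : Fin n → ℝ) (Sig : Matrix (Fin n) (Fin n) ℝ)
    (hSig : Sig.PosDef) (x : Fin (n+1) → ℝ) (hx : ∀ k, 0 < x k) :
    ContDiffAt ℝ 2 (LN n μ Sig) x ∧
      hessian (LN n μ Sig) x =
        Matrix.diagonal (fun k => (x k)⁻¹) *
          (1 - Smat n Sig⁻¹ + Matrix.diagonal (Umat n Sig⁻¹ *ᵥ (logTilde n x - μ))) *
          Matrix.diagonal (fun k => (x k)⁻¹) := by
  refine ⟨contDiffAt_LN μ Sig hx, ?_⟩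
  have hT : Sig⁻¹.IsSymm := by
    simpa [Matrix.IsHermitian, Matrix.IsSymm] using hSig.inv.isHermitian
  have hSsymm : (Smat n Sig⁻¹).IsSymm := by
    rw [Smat_eq_mul n hT, Umat_eq_mul, Matrix.IsSymm]
    simp only [Matrix.transpose_mul, Matrix.transpose_transpose, hT.eq, Matrix.mul_assoc]
  ext i j
  have hpos : ∀ᶠ y in nhds x, ∀ k, 0 < y k := Filter.eventually_all.2 fun k =>
    (continuous_apply k).continuousAt.eventually_const_lt (hx k)
  have hgrad : (fun y => fderiv ℝ (LN n μ Sig) y (Pi.single j (1:ℝ))) =ᶠ[nhds x]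
      fun y => -((y j)⁻¹ * ((∑ k, Umat n Sig⁻¹ j k * (logTilde n y k - μ k)) + 1)) := by
    filter_upwards [hpos] with y hy
    exact fderiv_LN_single μ hT hy j
  have hz : ∀ i, HasFDerivAt (fun y => logTilde n y i - μ i)
      (fderiv ℝ (fun y => logTilde n y i) x) x := fun i =>
    ((contDiffAt_logTilde hx (r := 1) i).differentiableAt one_ne_zero).hasFDerivAt.sub_const _
  have hinv : HasFDerivAt (fun y : Fin (n+1) → ℝ => (y j)⁻¹)
      ((-((x j) ^ 2)⁻¹) • ContinuousLinearMap.proj (R := ℝ) (φ := fun _ => ℝ) j) x :=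
    (hasDerivAt_inv (hx j).ne').comp_hasFDerivAt x (hasFDerivAt_apply j x)
  have hmain := (hinv.fun_mul ((HasFDerivAt.fun_sum fun k (_ : k ∈ Finset.univ) =>
    (hz k).const_mul (Umat n Sig⁻¹ j k)).add_const 1)).fun_neg
  have hS : ∑ k, Umat n Sig⁻¹ j k * ((x i)⁻¹ * Umat n 1 i k) = (x i)⁻¹ * Smat n Sig⁻¹ i j := by
    rw [← hSsymm.apply, Smat_eq_mul n hT, Matrix.mul_apply, Finset.mul_sum]
    exact Finset.sum_congr rfl fun k _ => by rw [Matrix.transpose_apply]; ring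
  rw [hessian, Matrix.of_apply, hgrad.fderiv_eq, hmain.fderiv]
  simp only [_root_.neg_apply, _root_.smul_apply,
    _root_.sum_apply, _root_.add_apply, smul_eq_mul,
    ContinuousLinearMap.proj_apply, fderiv_logTilde_single hx, hS, Matrix.mul_diagonal,
    Matrix.diagonal_mul, Matrix.add_apply, Matrix.sub_apply]
  by_cases hij : i = j
  · subst hij
    simp only [Pi.single_eq_same, Matrix.one_apply_eq, Matrix.diagonal_apply_eq, mulVec,
      dotProduct, Pi.sub_apply]
    ring
  · simp only [Pi.single_eq_of_ne (Ne.symm hij), Matrix.one_apply_ne hij,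
      Matrix.diagonal_apply_ne _ hij]
    ring
end
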